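/- arXiv:1601.06698 — 2 statements merged into one kernel-verified Lean document; each statement's English description precedes it below -/
import Mathlib

section
/- Let d, m, ε, a be integers with d ≥ 18, d - 1 = 3m + ε, 0 ≤ ε ≤ 2, -m ≤ a, and 2a ≤ m + ε - 1. Then φ(a) ≥ -d(d-6), and equality φ(a) = -d(d-6) holds if and only if 2a = m + ε - 1 (in particular equality forces d to be even). -/
/-- For integers `m, ε`, `φ(a) = -6a³ + (-9m+5+3ε)a² + (2m(3ε-4)-6ε+10)a
    + 3m³ + (3ε-13)m² + (10-6ε)m + 8`.  If `d ≥ 18`, `d - 1 = 3m + ε`,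
    `0 ≤ ε ≤ 2`, `-m ≤ a` and `2a ≤ m + ε - 1`, then `φ(a) ≥ -d(d-6)`, with
    equality iff `2a = m + ε - 1` (and equality forces `d` even). -/
theorem stmt_0 (d m ε a : ℤ) (hd : 18 ≤ d) (hdec : d - 1 = 3 * m + ε)
    (hε0 : 0 ≤ ε) (hε2 : ε ≤ 2) (ha1 : -m ≤ a) (ha2 : 2 * a ≤ m + ε - 1) :
    -6 * a ^ 3 + (-9 * m + 5 + 3 * ε) * a ^ 2 + (2 * m * (3 * ε - 4) - 6 * ε + 10) * a
        + 3 * m ^ 3 + (3 * ε - 13) * m ^ 2 + (10 - 6 * ε) * m + 8 ≥ -d * (d - 6) ∧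
      ((-6 * a ^ 3 + (-9 * m + 5 + 3 * ε) * a ^ 2 + (2 * m * (3 * ε - 4) - 6 * ε + 10) * a
          + 3 * m ^ 3 + (3 * ε - 13) * m ^ 2 + (10 - 6 * ε) * m + 8 = -d * (d - 6)) ↔
        2 * a = m + ε - 1) ∧
      ((-6 * a ^ 3 + (-9 * m + 5 + 3 * ε) * a ^ 2 + (2 * m * (3 * ε - 4) - 6 * ε + 10) * a
          + 3 * m ^ 3 + (3 * ε - 13) * m ^ 2 + (10 - 6 * ε) * m + 8 = -d * (d - 6)) →
        Even d) := by
  obtain rfl : d = 3 * m + ε + 1 := by omega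
  set K := -6 * a ^ 3 + (-9 * m + 5 + 3 * ε) * a ^ 2
    + (2 * m * (3 * ε - 4) - 6 * ε + 10) * a
    + 3 * m ^ 3 + (3 * ε - 13) * m ^ 2 + (10 - 6 * ε) * m + 8 with hK
  have hfactor : K + (3 * m + ε + 1) * (3 * m + ε + 1 - 6)
      = (m + ε - 1 - 2 * a) * (3 * (a + m) ^ 2 - 4 * (a + m) + 3 * m - 3 + ε) := by
    rw [hK]
    interval_cases ε <;> ring
  have hpos : 0 < 3 * (a + m) ^ 2 - 4 * (a + m) + 3 * m - 3 + ε := by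
    nlinarith [sq_nonneg (3 * (a + m) - 2)]
  have hiff : K = -(3 * m + ε + 1) * (3 * m + ε + 1 - 6) ↔ 2 * a = m + ε - 1 := by
    constructor
    · intro h
      have hzero : (m + ε - 1 - 2 * a)
          * (3 * (a + m) ^ 2 - 4 * (a + m) + 3 * m - 3 + ε) = 0 := by
        linarith
      have := (mul_eq_zero.mp hzero).resolve_right hpos.ne'
      linarith
    · intro h
      rw [show m + ε - 1 - 2 * a = 0 by linarith, zero_mul] at hfactor
      linarith
  refine ⟨?_, hiff, fun h => ⟨3 * a - ε + 2, ?_⟩⟩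
  · have := mul_nonneg (show 0 ≤ m + ε - 1 - 2 * a by linarith) hpos.le
    linarith
  · have := hiff.mp h
    linarith
end

section
/- For all integers r, ε, d with r ≥ 5, 0 ≤ ε ≤ r - 3, d ≥ r - 1 and d ≥ 6, one has (r-4)d² - (3r-10)d + 2(r + ε² - εr + 2ε - 3) > 0. -/
/-- For all integers `r ≥ 5`, `0 ≤ ε ≤ r - 3`, `d ≥ r - 1`, `d ≥ 6`:
    `(r-4)d² - (3r-10)d + 2(r + ε² - εr + 2ε - 3) > 0`. -/
theorem stmt_11 (r ε d : ℤ) (hr : 5 ≤ r) (hε0 : 0 ≤ ε) (hε : ε ≤ r - 3)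
    (hd1 : r - 1 ≤ d) (hd2 : 6 ≤ d) :
    0 < (r - 4) * d ^ 2 - (3 * r - 10) * d + 2 * (r + ε ^ 2 - ε * r + 2 * ε - 3) := by
  have hsq : 0 ≤ (2 * ε - (r - 2)) ^ 2 := sq_nonneg _
  have hlin : d * (3 * r - 14) ≤ d * ((r - 4) * d - 3 * r + 10) :=
    mul_le_mul_of_nonneg_left (by nlinarith) (by linarith)
  have hdr : (r - 1) * (3 * r - 14) ≤ d * (3 * r - 14) :=
    mul_le_mul_of_nonneg_right hd1 (by linarith)
  nlinarith
end
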